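/- Let M be a left LCM monoid, that is, M is right cancellative and principally left ideal Howson. Then the special semidirect product S(M) is left ideal Howson and finitely left equated (hence weakly left coherent). -/

import Mathlib

open Pointwise

/-- The special semidirect product `S(M) = P(M) ⋊ M`. -/
structure SSP (M : Type*) [Monoid M] where
  carrier : Set M
  elt : M

namespace SSP

variable {M : Type*} [Monoid M]

instance : Mul (SSP M) :=
  ⟨fun s t => ⟨s.carrier ∪ s.elt • t.carrier, s.elt * t.elt⟩⟩

instance : One (SSP M) := ⟨⟨∅, 1⟩⟩

theorem mul_def (s t : SSP M) :
    s * t = ⟨s.carrier ∪ s.elt • t.carrier, s.elt * t.elt⟩ := rfl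

theorem one_def : (1 : SSP M) = ⟨∅, 1⟩ := rfl

instance instMonoid : Monoid (SSP M) where
  mul_assoc s t u := by
    simp only [mul_def, mk.injEq]
    constructor
    · rw [mul_smul, Set.smul_set_union, Set.union_assoc]
    · exact mul_assoc _ _ _
  one_mul s := by
    cases s
    simp [mul_def, one_def]
  mul_one s := by
    cases s
    simp [mul_def, one_def]

end SSP

section Defs

variable {N : Type*} [Monoid N]

/-- `a⁻¹A = {u ∈ M : au ∈ A}`. -/
def preSet {M : Type*} [Monoid M] (a : M) (A : Set M) : Set M := {u | a * u ∈ A}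

/-- `a R* b` iff `ua = va ⇔ ub = vb` for all `u, v`. -/
def RStarRel (a b : N) : Prop := ∀ u v : N, u * a = v * a ↔ u * b = v * b

/-- `a L* b` iff `au = av ⇔ bu = bv` for all `u, v`. -/
def LStarRel (a b : N) : Prop := ∀ u v : N, a * u = a * v ↔ b * u = b * v

/-- `a R̃_E b` iff `a` and `b` have the same idempotent left identities in `E`. -/
def RTilde (E : Set N) (a b : N) : Prop := {e ∈ E | e * a = a} = {e ∈ E | e * b = b}

/-- `a L̃_E b` iff `a` and `b` have the same idempotent right identities in `E`. -/
def LTilde (E : Set N) (a b : N) : Prop := {e ∈ E | a * e = a} = {e ∈ E | b * e = b}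

/-- The principal right ideal `aN`. -/
def rIdeal (a : N) : Set N := {x | ∃ m : N, x = a * m}

/-- The principal left ideal `Na`. -/
def lIdeal (a : N) : Set N := {x | ∃ m : N, x = m * a}

/-- A monoid is left abundant if every `R*`-class contains an idempotent. -/
def LeftAbundant (N : Type*) [Monoid N] : Prop :=
  ∀ a : N, ∃ e : N, IsIdempotentElem e ∧ RStarRel a e

/-- A monoid is right abundant if every `L*`-class contains an idempotent. -/
def RightAbundant (N : Type*) [Monoid N] : Prop :=
  ∀ a : N, ∃ e : N, IsIdempotentElem e ∧ LStarRel a e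

/-- Condition (R). -/
def CondR (N : Type*) [Monoid N] : Prop :=
  ∀ a b : N, ∃ X : Set (N × N), X.Finite ∧ (∀ p ∈ X, a * p.1 = b * p.2) ∧
    ∀ u v : N, a * u = b * v ↔ ∃ p ∈ X, ∃ m : N, u = p.1 * m ∧ v = p.2 * m

/-- Condition (L). -/
def CondL (N : Type*) [Monoid N] : Prop :=
  ∀ a b : N, ∃ X : Set (N × N), X.Finite ∧ (∀ p ∈ X, p.1 * a = p.2 * b) ∧
    ∀ u v : N, u * a = v * b ↔ ∃ p ∈ X, ∃ m : N, u = m * p.1 ∧ v = m * p.2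

/-- Right ideal Howson monoid. -/
def RightIdealHowson (N : Type*) [Monoid N] : Prop :=
  ∀ a b : N, ∃ F : Set N, F.Finite ∧ rIdeal a ∩ rIdeal b = ⋃ f ∈ F, rIdeal f

/-- Left ideal Howson monoid. -/
def LeftIdealHowson (N : Type*) [Monoid N] : Prop :=
  ∀ a b : N, ∃ F : Set N, F.Finite ∧ lIdeal a ∩ lIdeal b = ⋃ f ∈ F, lIdeal f

/-- Principally right ideal Howson monoid. -/
def PrincipallyRightIdealHowson (N : Type*) [Monoid N] : Prop :=
  ∀ a b : N, (rIdeal a ∩ rIdeal b).Nonempty → ∃ u : N, rIdeal a ∩ rIdeal b = rIdeal u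

/-- Principally left ideal Howson monoid. -/
def PrincipallyLeftIdealHowson (N : Type*) [Monoid N] : Prop :=
  ∀ a b : N, (lIdeal a ∩ lIdeal b).Nonempty → ∃ u : N, lIdeal a ∩ lIdeal b = lIdeal u

/-- Strongly right ideal Howson monoid. -/
def StronglyRightIdealHowson (N : Type*) [Monoid N] : Prop :=
  ∀ a b : N, (rIdeal a ∩ rIdeal b).Nonempty →
    ∃ (n : ℕ) (u : Fin n → N), 1 ≤ n ∧ (∀ i, u i ∈ rIdeal a ∩ rIdeal b) ∧
      (rIdeal a ∩ rIdeal b = ⋃ i, rIdeal (u i)) ∧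
      (∀ i, ((rIdeal a ∩ rIdeal b) \ rIdeal (u i)).Finite)

/-- A finite left co-ordinate system for `a, b` with respect to `A, B`. -/
def LeftCoordSystem {M : Type*} [Monoid M] (a b : M) (A B : Set M) (C : Set (M × M)) : Prop :=
  C.Finite ∧ C ⊆ {pq : M × M | pq.1 * a = pq.2 * b} ∧
    ∀ x y : M, x * a = y * b → ∃ t : M, ∃ pq ∈ C,
      x * a = t * pq.1 * a ∧ (t * pq.1) • A ∪ (t * pq.2) • B ⊆ x • A ∪ y • B

/-- A left co-ordinated monoid. -/
def LeftCoordinated (M : Type*) [Monoid M] : Prop :=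
  ∀ (a b : M) (A B : Set M), ∃ C : Set (M × M), LeftCoordSystem a b A B C

/-- A left 1-co-ordinated monoid. -/
def Left1Coordinated (M : Type*) [Monoid M] : Prop :=
  ∀ (a b : M) (A B : Set M), ∃ C : Set (M × M), LeftCoordSystem a b A B C ∧ C.Subsingleton

/-- A right congruence: an equivalence relation compatible with right multiplication. -/
def IsRightCong (r : N → N → Prop) : Prop :=
  Equivalence r ∧ ∀ a b c : N, r a b → r (a * c) (b * c)

/-- A left congruence: an equivalence relation compatible with left multiplication. -/
def IsLeftCong (r : N → N → Prop) : Prop :=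
  Equivalence r ∧ ∀ a b c : N, r a b → r (c * a) (c * b)

/-- The right congruence generated by a set of pairs. -/
def rightCongGen (W : Set (N × N)) : N → N → Prop :=
  fun a b => ∀ r : N → N → Prop, IsRightCong r → (∀ p ∈ W, r p.1 p.2) → r a b

/-- The left congruence generated by a set of pairs. -/
def leftCongGen (W : Set (N × N)) : N → N → Prop :=
  fun a b => ∀ r : N → N → Prop, IsLeftCong r → (∀ p ∈ W, r p.1 p.2) → r a b

/-- The right annihilator congruence `r(s)`. -/
def rAnn (s : N) : N → N → Prop := fun u v => s * u = s * v

/-- The left annihilator congruence `l(s)`. -/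
def lAnn (s : N) : N → N → Prop := fun u v => u * s = v * s

/-- Finitely right equated monoid. -/
def FinitelyRightEquated (N : Type*) [Monoid N] : Prop :=
  ∀ s : N, ∃ W : Set (N × N), W.Finite ∧ rAnn s = rightCongGen W

/-- Finitely left equated monoid. -/
def FinitelyLeftEquated (N : Type*) [Monoid N] : Prop :=
  ∀ s : N, ∃ W : Set (N × N), W.Finite ∧ lAnn s = leftCongGen W

/-- An indecomposable element: its only factors are `1` and itself. -/
def Indecomposable (b : N) : Prop :=
  ∀ u v : N, b = u * v → (u = 1 ∨ u = b) ∧ (v = 1 ∨ v = b)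

end Defs

/-- In `S(M)`, `(Z, z)` lies in the principal left ideal of `(A, a)` iff `z = xa` with
`xA ⊆ Z`. -/
theorem SSP.mem_lIdeal_iff {M : Type*} [Monoid M] {s z : SSP M} :
    z ∈ lIdeal s ↔ ∃ x : M, z.elt = x * s.elt ∧ x • s.carrier ⊆ z.carrier := by
  obtain ⟨Z, z⟩ := z
  constructor
  · rintro ⟨⟨X, x⟩, h⟩
    simp only [SSP.mul_def, SSP.mk.injEq] at h
    exact ⟨x, h.2, h.1 ▸ Set.subset_union_right⟩
  · rintro ⟨x, hx, hsub⟩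
    refine ⟨⟨Z, x⟩, ?_⟩
    simp only [SSP.mul_def, SSP.mk.injEq]
    exact ⟨(Set.union_eq_left.2 hsub).symm, hx⟩

theorem SSP.leftIdealHowson {M : Type*} [Monoid M] (hc : ∀ u v a : M, u * a = v * a → u = v)
    (hp : PrincipallyLeftIdealHowson M) : LeftIdealHowson (SSP M) := by
  intro s t
  by_cases hne : (lIdeal s.elt ∩ lIdeal t.elt).Nonempty
  · obtain ⟨u, hu⟩ := hp _ _ hne
    obtain ⟨⟨p, hpu⟩, ⟨q, hqu⟩⟩ : u ∈ lIdeal s.elt ∩ lIdeal t.elt :=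
      hu ▸ ⟨1, (one_mul u).symm⟩
    refine ⟨{⟨p • s.carrier ∪ q • t.carrier, u⟩}, Set.finite_singleton _, ?_⟩
    ext z
    simp only [Set.biUnion_singleton, Set.mem_inter_iff, SSP.mem_lIdeal_iff,
      Set.smul_set_union, Set.union_subset_iff, smul_smul]
    constructor
    · rintro ⟨⟨x, hx, hxs⟩, ⟨y, hy, hyt⟩⟩
      obtain ⟨m, hm⟩ : z.elt ∈ lIdeal u := hu ▸ ⟨⟨x, hx⟩, ⟨y, hy⟩⟩
      obtain rfl : x = m * p := hc _ _ s.elt (by rw [← hx, hm, hpu, mul_assoc])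
      obtain rfl : y = m * q := hc _ _ t.elt (by rw [← hy, hm, hqu, mul_assoc])
      exact ⟨m, hm, hxs, hyt⟩
    · rintro ⟨m, hm, hs, ht⟩
      exact ⟨⟨m * p, by rw [hm, hpu, mul_assoc], hs⟩, ⟨m * q, by rw [hm, hqu, mul_assoc], ht⟩⟩
  · refine ⟨∅, Set.finite_empty, ?_⟩
    simp only [Set.mem_empty_iff_false, Set.iUnion_of_empty, Set.iUnion_empty]
    refine Set.eq_empty_of_forall_notMem fun z hz => hne ⟨z.elt, ?_⟩
    obtain ⟨x, hx, -⟩ := SSP.mem_lIdeal_iff.1 hz.1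
    obtain ⟨y, hy, -⟩ := SSP.mem_lIdeal_iff.1 hz.2
    exact ⟨⟨x, hx⟩, ⟨y, hy⟩⟩

theorem lAnn_isLeftCong {N : Type*} [Monoid N] (s : N) : IsLeftCong (lAnn s) :=
  ⟨⟨fun _ => rfl, Eq.symm, Eq.trans⟩, fun a b c h => by
    unfold lAnn at *
    rw [mul_assoc, h, mul_assoc]⟩

/-- For right cancellative `M`, the left annihilator congruence of `(A, a)` in `S(M)` is generated
by the single pair `((∅, 1), (A, 1))`. -/
theorem SSP.finitelyLeftEquated {M : Type*} [Monoid M]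
    (hc : ∀ u v a : M, u * a = v * a → u = v) : FinitelyLeftEquated (SSP M) := by
  rintro ⟨A, a⟩
  refine ⟨{(1, ⟨A, 1⟩)}, Set.finite_singleton _, ?_⟩
  ext ⟨X, x⟩ ⟨Y, y⟩
  constructor
  · intro h r hr hW
    simp only [lAnn, SSP.mul_def, SSP.mk.injEq] at h
    obtain ⟨hXY, hxy⟩ := h
    obtain rfl := hc _ _ _ hxy
    have absorb (Z : Set M) : r ⟨Z, x⟩ ⟨Z ∪ x • A, x⟩ := by
      simpa only [mul_one, SSP.mul_def] using hr.2 1 ⟨A, 1⟩ ⟨Z, x⟩ (hW _ rfl)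
    exact hr.1.trans (absorb X) (hXY ▸ hr.1.symm (absorb Y))
  · intro h
    refine h _ (lAnn_isLeftCong _) ?_
    rintro _ rfl
    simp [lAnn, SSP.mul_def]

theorem stmt19 (M : Type*) [Monoid M] (hc : ∀ u v a : M, u * a = v * a → u = v)
    (hp : PrincipallyLeftIdealHowson M) :
    LeftIdealHowson (SSP M) ∧ FinitelyLeftEquated (SSP M) :=
  ⟨SSP.leftIdealHowson hc hp, SSP.finitelyLeftEquated hc⟩
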